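/- arXiv:math/0503396 — 4 statements merged into one kernel-verified Lean document; each statement's English description precedes it below -/
import Mathlib

section
/- Let u₁, u₂, v₁, v₂ ∈ ℂ with u₁−v₂ ∉ ℤ_{≤0} and v₁−v₂ ∉ ℤ_{≤0}. Define the operator ℛ₁ = D₂[u₁−v₂, v₁−v₂] on ℂ[z₁,z₂] by ℛ₁(z₁ʲ(z₂−z₁)ᵏ) = (Γ(k+u₁−v₂)/Γ(k+v₁−v₂)) · z₁ʲ(z₂−z₁)ᵏ on the basis {z₁ʲ(z₂−z₁)ᵏ : j,k ∈ ℕ}. Then ℛ₁ satisfies the defining equation ℛ₁ L₁(u₁,u₂) L₂(v₁,v₂) = L₁(v₁,u₂) L₂(u₁,v₂) ℛ₁, an identity of 2×2 matrices of operators where ℛ₁ stands for ℛ₁ times the identity matrix. -/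
open MvPolynomial

/-- Multiplication by `zᵢ` on `ℂ[z₁,z₂]` (indices `0,1` for `1,2`). -/
noncomputable def Zm (i : Fin 2) : Module.End ℂ (MvPolynomial (Fin 2) ℂ) :=
  LinearMap.mulLeft ℂ (X i)

/-- Partial derivative `∂ᵢ = ∂/∂zᵢ` on `ℂ[z₁,z₂]`. -/
noncomputable def Dm (i : Fin 2) : Module.End ℂ (MvPolynomial (Fin 2) ℂ) :=
  (pderiv i).toLinearMap

/-- The `sl(2)` Lax matrix `Lᵢ(a,b) = [[a + zᵢ∂ᵢ, −∂ᵢ], [zᵢ²∂ᵢ + (a−b)zᵢ, b − zᵢ∂ᵢ]]`. -/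
noncomputable def Lax (i : Fin 2) (a b : ℂ) :
    Matrix (Fin 2) (Fin 2) (Module.End ℂ (MvPolynomial (Fin 2) ℂ)) :=
  !![a • 1 + Zm i * Dm i, -Dm i;
     Zm i * Zm i * Dm i + (a - b) • Zm i, b • 1 - Zm i * Dm i]

/-- The scalar 2×2 matrix `R·Id`. -/
noncomputable def SM (R : Module.End ℂ (MvPolynomial (Fin 2) ℂ)) :
    Matrix (Fin 2) (Fin 2) (Module.End ℂ (MvPolynomial (Fin 2) ℂ)) :=
  Matrix.scalar (Fin 2) R

/-- A linear map on `ℂ[z₁,z₂]` is determined by its values on the `z₁ʲ(z₂−z₁)ᵏ`. -/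
theorem linearMap_ext_shifted_monomials {f g : Module.End ℂ (MvPolynomial (Fin 2) ℂ)}
    (h : ∀ j k : ℕ, f (X 0 ^ j * (X 1 - X 0) ^ k) = g (X 0 ^ j * (X 1 - X 0) ^ k)) :
    f = g := by
  let φ : MvPolynomial (Fin 2) ℂ →ₐ[ℂ] MvPolynomial (Fin 2) ℂ := aeval ![X 0, X 1 - X 0]
  let ψ : MvPolynomial (Fin 2) ℂ →ₐ[ℂ] MvPolynomial (Fin 2) ℂ := aeval ![X 0, X 1 + X 0]
  have hφψ : φ.comp ψ = AlgHom.id ℂ _ := by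
    ext1 i
    fin_cases i <;> simp [φ, ψ]
  have hfg : f ∘ₗ φ.toLinearMap = g ∘ₗ φ.toLinearMap := by
    refine (basisMonomials (Fin 2) ℂ).ext fun s => ?_
    simpa [φ, aeval_monomial, Finsupp.prod_fintype, -aeval_eq_bind₁]
      using h (s 0) (s 1)
  refine LinearMap.ext fun p => ?_
  have hp : φ (ψ p) = p := DFunLike.congr_fun hφψ p
  simpa [hp] using LinearMap.congr_fun hfg (ψ p)

/-- `∂₁ + ∂₂`, the derivative in `z₁` at fixed `z₂ − z₁`. -/
noncomputable def shiftDeriv : Module.End ℂ (MvPolynomial (Fin 2) ℂ) := Dm 0 + Dm 1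

/-- Multiplication by `z₂ − z₁`. -/
noncomputable def diffMul : Module.End ℂ (MvPolynomial (Fin 2) ℂ) := Zm 1 - Zm 0

/-- The Euler operator `(z₂ − z₁)∂₂`. -/
noncomputable def diffEuler : Module.End ℂ (MvPolynomial (Fin 2) ℂ) := diffMul * Dm 1

/-- The operator `∂₂((z₂ − z₁)∂₂ + a − 1)`, lowering the degree in `z₂ − z₁` by one. -/
noncomputable def lowering (a : ℂ) : Module.End ℂ (MvPolynomial (Fin 2) ℂ) :=
  Dm 1 * (diffEuler + (a - 1) • 1)

/-- The operator `(z₂ − z₁)((z₂ − z₁)∂₂ + b)`, raising the degree in `z₂ − z₁` by one. -/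
noncomputable def raising (b : ℂ) : Module.End ℂ (MvPolynomial (Fin 2) ℂ) :=
  diffMul * (diffEuler + b • 1)

theorem Zm_apply (i : Fin 2) (p : MvPolynomial (Fin 2) ℂ) : Zm i p = X i * p := rfl

theorem Dm_apply (i : Fin 2) (p : MvPolynomial (Fin 2) ℂ) : Dm i p = pderiv i p := rfl

theorem diffMul_apply (p : MvPolynomial (Fin 2) ℂ) : diffMul p = (X 1 - X 0) * p := by
  simp [diffMul, Zm_apply, sub_mul]

theorem pderiv_one_shifted_monomial (j k : ℕ) :
    pderiv 1 (X 0 ^ j * (X 1 - X 0) ^ k : MvPolynomial (Fin 2) ℂ) =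
      (k : ℂ) • (X 0 ^ j * (X 1 - X 0) ^ (k - 1)) := by
  simp [Derivation.leibniz, Derivation.leibniz_pow, pderiv_X, smul_eq_C_mul]
  ring

theorem diffEuler_shifted_monomial (j k : ℕ) :
    diffEuler (X 0 ^ j * (X 1 - X 0) ^ k) = (k : ℂ) • (X 0 ^ j * (X 1 - X 0) ^ k) := by
  rw [diffEuler, Module.End.mul_apply, Dm_apply, pderiv_one_shifted_monomial, map_smul,
    diffMul_apply]
  cases k with
  | zero => simp
  | succ k => rw [Nat.add_sub_cancel]; congr 1; ring

theorem shiftDeriv_shifted_monomial (j k : ℕ) :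
    shiftDeriv (X 0 ^ j * (X 1 - X 0) ^ k) =
      (j : ℂ) • (X 0 ^ (j - 1) * (X 1 - X 0) ^ k) := by
  simp [shiftDeriv, Dm_apply, Derivation.leibniz, Derivation.leibniz_pow, pderiv_X,
    smul_eq_C_mul]
  ring

theorem lowering_shifted_monomial (a : ℂ) (j k : ℕ) :
    lowering a (X 0 ^ j * (X 1 - X 0) ^ k) =
      ((k + (a - 1)) * k) • (X 0 ^ j * (X 1 - X 0) ^ (k - 1)) := by
  simp only [lowering, Module.End.mul_apply, LinearMap.add_apply, LinearMap.smul_apply,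
    Module.End.one_apply, diffEuler_shifted_monomial, ← add_smul, map_smul, Dm_apply,
    pderiv_one_shifted_monomial, smul_smul]

theorem raising_shifted_monomial (b : ℂ) (j k : ℕ) :
    raising b (X 0 ^ j * (X 1 - X 0) ^ k) =
      ((k : ℂ) + b) • (X 0 ^ j * (X 1 - X 0) ^ (k + 1)) := by
  simp only [raising, Module.End.mul_apply, LinearMap.add_apply, LinearMap.smul_apply,
    Module.End.one_apply, diffEuler_shifted_monomial, ← add_smul, map_smul, diffMul_apply]
  congr 1
  ring

section Intertwining

variable {R : Module.End ℂ (MvPolynomial (Fin 2) ℂ)} {r : ℕ → ℂ}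

theorem semiconjBy_Zm_zero
    (hR : ∀ j k : ℕ, R (X 0 ^ j * (X 1 - X 0) ^ k) = r k • (X 0 ^ j * (X 1 - X 0) ^ k)) :
    SemiconjBy R (Zm 0) (Zm 0) := by
  refine linearMap_ext_shifted_monomials fun j k => ?_
  simp only [Module.End.mul_apply, hR, map_smul, Zm_apply]
  rw [← mul_assoc, ← pow_succ', hR]

theorem semiconjBy_shiftDeriv
    (hR : ∀ j k : ℕ, R (X 0 ^ j * (X 1 - X 0) ^ k) = r k • (X 0 ^ j * (X 1 - X 0) ^ k)) :
    SemiconjBy R shiftDeriv shiftDeriv := by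
  refine linearMap_ext_shifted_monomials fun j k => ?_
  simp only [Module.End.mul_apply, hR, map_smul, shiftDeriv_shifted_monomial]
  rw [smul_comm]

theorem semiconjBy_diffEuler
    (hR : ∀ j k : ℕ, R (X 0 ^ j * (X 1 - X 0) ^ k) = r k • (X 0 ^ j * (X 1 - X 0) ^ k)) :
    SemiconjBy R diffEuler diffEuler := by
  refine linearMap_ext_shifted_monomials fun j k => ?_
  simp only [Module.End.mul_apply, hR, map_smul, diffEuler_shifted_monomial]
  rw [smul_comm]

variable {a b : ℂ}

theorem semiconjBy_lowering
    (hR : ∀ j k : ℕ, R (X 0 ^ j * (X 1 - X 0) ^ k) = r k • (X 0 ^ j * (X 1 - X 0) ^ k))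
    (hr : ∀ k : ℕ, r (k + 1) * (k + b) = r k * (k + a)) :
    SemiconjBy R (lowering a) (lowering b) := by
  refine linearMap_ext_shifted_monomials fun j k => ?_
  simp only [Module.End.mul_apply, hR, map_smul, lowering_shifted_monomial, smul_smul]
  cases k with
  | zero => simp
  | succ k =>
    rw [Nat.add_sub_cancel]
    congr 1
    push_cast
    linear_combination (-(k : ℂ) - 1) * hr k

theorem semiconjBy_raising
    (hR : ∀ j k : ℕ, R (X 0 ^ j * (X 1 - X 0) ^ k) = r k • (X 0 ^ j * (X 1 - X 0) ^ k))
    (hr : ∀ k : ℕ, r (k + 1) * (k + b) = r k * (k + a)) :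
    SemiconjBy R (raising b) (raising a) := by
  refine linearMap_ext_shifted_monomials fun j k => ?_
  simp only [Module.End.mul_apply, hR, map_smul, raising_shifted_monomial, smul_smul]
  congr 1
  linear_combination hr k

end Intertwining

theorem SemiconjBy.const_smul_right {A : Type*} [Ring A] [Algebra ℂ A] {x y z : A} (c : ℂ)
    (h : SemiconjBy x y z) : SemiconjBy x (c • y) (c • z) := by
  simp only [SemiconjBy, mul_smul_comm, smul_mul_assoc, h.eq]

theorem pderiv_one_pderiv_zero (p : MvPolynomial (Fin 2) ℂ) :
    pderiv 1 (pderiv 0 p) = pderiv 0 (pderiv 1 p) := by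
  have h : ⁅pderiv (R := ℂ) (1 : Fin 2), pderiv (R := ℂ) (0 : Fin 2)⁆ = 0 := by
    ext1 i
    fin_cases i <;> simp [Derivation.commutator_apply, pderiv_X]
  have := DFunLike.congr_fun h p
  rwa [Derivation.commutator_apply, Derivation.zero_apply, sub_eq_zero] at this

set_option maxHeartbeats 400000 in
/-- The product `L₁(u₁,u₂)L₂(v₁,v₂)` in terms of the operators that `ℛ₁` intertwines. -/
theorem Lax_mul_Lax (u₁ u₂ v₁ v₂ : ℂ) :
    Lax 0 u₁ u₂ * Lax 1 v₁ v₂ =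
      !![(u₁ * v₁) • 1 + (u₁ - v₂ + v₁) • diffEuler + diffEuler * (diffEuler - 1)
            + v₂ • (Zm 0 * shiftDeriv) - Zm 0 * diffEuler * shiftDeriv
            + Zm 0 * lowering (u₁ - v₂) - raising (v₁ - v₂) * shiftDeriv,
          shiftDeriv * diffEuler - v₂ • shiftDeriv - lowering (u₁ - v₂);
         (u₁ * v₁ - u₂ * v₂) • Zm 0 + (u₁ - v₂ + v₁ + u₂) • (Zm 0 * diffEuler)
            + Zm 0 * (diffEuler * (diffEuler - 1))
            + v₂ • (Zm 0 * Zm 0 * shiftDeriv) - Zm 0 * Zm 0 * diffEuler * shiftDeriv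
            + Zm 0 * Zm 0 * lowering (u₁ - v₂)
            + u₂ • raising (v₁ - v₂) - Zm 0 * shiftDeriv * raising (v₁ - v₂),
          (u₂ * v₂) • 1 - u₂ • diffEuler - v₂ • (Zm 0 * shiftDeriv)
            + Zm 0 * diffEuler * shiftDeriv - Zm 0 * lowering (u₁ - v₂)] := by
  rw [Lax, Lax, Matrix.mul_fin_two]
  ext1 i j
  fin_cases i <;> fin_cases j <;> refine LinearMap.ext fun p => ?_ <;>
  · simp [lowering, raising, diffEuler, shiftDeriv, diffMul_apply, Zm_apply, Dm_apply,
      smul_eq_C_mul, Derivation.leibniz, pderiv_X, pderiv_one_pderiv_zero]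
    ring

theorem Gamma_ratio_succ {a b : ℂ} (ha : ∀ n : ℕ, a ≠ -(n : ℂ)) (hb : ∀ n : ℕ, b ≠ -(n : ℂ))
    (k : ℕ) :
    Complex.Gamma (((k + 1 : ℕ) : ℂ) + a) / Complex.Gamma (((k + 1 : ℕ) : ℂ) + b) * (k + b) =
      Complex.Gamma (k + a) / Complex.Gamma (k + b) * (k + a) := by
  have hka : (k : ℂ) + a ≠ 0 := fun h => ha k (by linear_combination h)
  have hkb : (k : ℂ) + b ≠ 0 := fun h => hb k (by linear_combination h)
  have hΓ : Complex.Gamma (k + b) ≠ 0 := Complex.Gamma_ne_zero fun m h =>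
    hb (k + m) (by push_cast; linear_combination h)
  rw [show ((k + 1 : ℕ) : ℂ) + a = k + a + 1 by push_cast; ring,
    show ((k + 1 : ℕ) : ℂ) + b = k + b + 1 by push_cast; ring,
    Complex.Gamma_add_one _ hka, Complex.Gamma_add_one _ hkb]
  field_simp

/-- The operator `ℛ₁ = D₂[u₁−v₂, v₁−v₂]`, acting diagonally on the basis
`z₁ʲ(z₂−z₁)ᵏ` with eigenvalue `Γ(k+u₁−v₂)/Γ(k+v₁−v₂)`, satisfies the defining equation
`ℛ₁ L₁(u₁,u₂) L₂(v₁,v₂) = L₁(v₁,u₂) L₂(u₁,v₂) ℛ₁`. -/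
theorem R1_defining_equation (u₁ u₂ v₁ v₂ : ℂ)
    (h₁ : ∀ n : ℕ, u₁ - v₂ ≠ -(n : ℂ)) (h₂ : ∀ n : ℕ, v₁ - v₂ ≠ -(n : ℂ))
    (R : Module.End ℂ (MvPolynomial (Fin 2) ℂ))
    (hR : ∀ j k : ℕ,
      R ((X 0) ^ j * (X 1 - X 0) ^ k)
        = (Complex.Gamma ((k : ℂ) + (u₁ - v₂)) / Complex.Gamma ((k : ℂ) + (v₁ - v₂)))
            • ((X 0) ^ j * (X 1 - X 0) ^ k)) :
    SM R * (Lax 0 u₁ u₂ * Lax 1 v₁ v₂) = Lax 0 v₁ u₂ * Lax 1 u₁ v₂ * SM R := by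
  have hr := Gamma_ratio_succ h₁ h₂
  have hone := SemiconjBy.one_right R
  have hZ := semiconjBy_Zm_zero hR
  have hD := semiconjBy_shiftDeriv hR
  have hE := semiconjBy_diffEuler hR
  have hL := semiconjBy_lowering hR hr
  have hU := semiconjBy_raising hR hr
  have hEE := hE.mul_right (hE.sub_right hone)
  have hZE := (hZ.mul_right hE).mul_right hD
  have hZZ := hZ.mul_right hZ
  rw [Lax_mul_Lax, Lax_mul_Lax, mul_comm v₁ u₁,
    show v₁ - v₂ + u₁ = u₁ - v₂ + v₁ by ring]
  ext1 i j
  simp only [SM, Matrix.scalar_apply, Matrix.diagonal_mul, Matrix.mul_diagonal]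
  fin_cases i <;> fin_cases j
  · exact ((((((hone.const_smul_right _).add_right (hE.const_smul_right _)).add_right
      hEE).add_right ((hZ.mul_right hD).const_smul_right _)).sub_right hZE).add_right
      (hZ.mul_right hL)).sub_right (hU.mul_right hD)
  · exact ((hD.mul_right hE).sub_right (hD.const_smul_right _)).sub_right hL
  · exact (((((((hZ.const_smul_right _).add_right
      ((hZ.mul_right hE).const_smul_right _)).add_right (hZ.mul_right hEE)).add_right
      ((hZZ.mul_right hD).const_smul_right _)).sub_right
      ((hZZ.mul_right hE).mul_right hD)).add_right (hZZ.mul_right hL)).add_right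
      (hU.const_smul_right _)).sub_right ((hZ.mul_right hD).mul_right hU)
  · exact ((((hone.const_smul_right _).sub_right (hE.const_smul_right _)).sub_right
      ((hZ.mul_right hD).const_smul_right _)).add_right hZE).sub_right (hZ.mul_right hL)
end

section
/- Let u₁, u₂, v₁, v₂ ∈ ℂ and let R be a ℂ-linear endomorphism of ℂ[z₁,z₂] such that (i) R commutes with multiplication by z₂, and (ii) R (L₁(u₁,u₂) + L₂(v₁,v₂)) = (L₁(u₁,v₂) + L₂(v₁,u₂)) R as 2×2 matrices of operators (i.e., four entrywise operator identities). Then R satisfies the second-order defining equation R L₁(u₁,u₂) L₂(v₁,v₂) = L₁(u₁,v₂) L₂(v₁,u₂) R. -/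
open MvPolynomial

/-- Multiplication by `z₁ - z₂` is left cancellable. -/
lemma Zm_sub_mul_cancel {A B : Module.End ℂ (MvPolynomial (Fin 2) ℂ)}
    (h : (Zm 0 - Zm 1) * A = (Zm 0 - Zm 1) * B) : A = B := by
  have hX : (X 0 - X 1 : MvPolynomial (Fin 2) ℂ) ≠ 0 :=
    sub_ne_zero.mpr fun h => by simpa using X_injective h
  refine LinearMap.ext fun f => ?_
  have := LinearMap.congr_fun h f
  simp only [Zm, Module.End.mul_apply, LinearMap.sub_apply, LinearMap.mulLeft_apply,
    ← sub_mul] at this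
  exact mul_left_cancel₀ hX this

lemma Dm_mul_Zm_self (i : Fin 2) : Dm i * Zm i = Zm i * Dm i + 1 := by
  refine LinearMap.ext fun f => ?_
  simp [Dm, Zm, Module.End.mul_apply]

lemma Dm_mul_Zm_of_ne {i j : Fin 2} (h : i ≠ j) : Dm i * Zm j = Zm j * Dm i := by
  refine LinearMap.ext fun f => ?_
  simp [Dm, Zm, Module.End.mul_apply, pderiv_X_of_ne h.symm]

lemma Zm_mul_comm (i j : Fin 2) : Zm i * Zm j = Zm j * Zm i := by
  refine LinearMap.ext fun f => ?_
  simp [Zm, Module.End.mul_apply, mul_left_comm]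

lemma Dm_mul_comm (i j : Fin 2) : Dm i * Dm j = Dm j * Dm i := by
  have h : ⁅pderiv (R := ℂ) i, pderiv (R := ℂ) j⁆ = 0 := by
    refine derivation_ext fun k => ?_
    simp [Derivation.commutator_apply, pderiv_X, Pi.single_apply, apply_ite]
  refine LinearMap.ext fun f => sub_eq_zero.mp ?_
  simpa [Dm, Derivation.commutator_apply] using DFunLike.congr_fun h f

lemma SM_mul_apply (R : Module.End ℂ (MvPolynomial (Fin 2) ℂ))
    (M : Matrix (Fin 2) (Fin 2) (Module.End ℂ (MvPolynomial (Fin 2) ℂ))) (i j : Fin 2) :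
    (SM R * M) i j = R * M i j :=
  Matrix.diagonal_mul _ _ _ _

lemma mul_SM_apply (R : Module.End ℂ (MvPolynomial (Fin 2) ℂ))
    (M : Matrix (Fin 2) (Fin 2) (Module.End ℂ (MvPolynomial (Fin 2) ℂ))) (i j : Fin 2) :
    (M * SM R) i j = M i j * R :=
  Matrix.mul_diagonal _ _ _ _

lemma mul_mul_eq_of_mul_eq {A : Type*} [Semigroup A] {a b c : A} (h : a * b = c) (t : A) :
    a * (b * t) = c * t := by
  rw [← mul_assoc, h]

section Intertwiner

/-- The matrix `Lax` for a pair of elements `z`, `d` of an arbitrary algebra. -/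
def laxMatrix {A : Type*} [Ring A] [Algebra ℂ A] (z d : A) (a b : ℂ) :
    Matrix (Fin 2) (Fin 2) A :=
  !![a • 1 + z * d, -d; z * z * d + (a - b) • z, b • 1 - z * d]

variable {A : Type*} [Ring A] [Algebra ℂ A] {x y w p q R : A} {α β : ℂ}

/-- If `R` commutes with `w p` and intertwines the raising operators `w (w p + α)` and
`w (w p + β)`, then it intertwines the lowering operators `(w p + β) p` and `(w p + α) p`. -/
lemma lowering_of_raising (hw : ∀ a b : A, w * a = w * b → a = b)
    (hpw : p * w = w * p + 1) (hθ : R * (w * p) = w * (p * R))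
    (hC : R * (w * (w * p)) = w * (w * (p * R)) + β • (w * R) - α • (R * w)) :
    R * (w * (p * p)) = w * (p * (p * R)) + α • (p * R) - β • (R * p) := by
  apply hw
  have hpw' := mul_mul_eq_of_mul_eq hpw
  have hθ' : ∀ t, R * (w * (p * t)) = w * (p * (R * t)) := fun t => by
    simpa only [mul_assoc] using congrArg (· * t) hθ
  have h := congrArg (· * p) hC
  have hsq : R * (w * (w * (p * p))) = w * (w * (p * (p * R))) := by
    have e : w * (w * (p * p)) = w * (p * (w * p)) - w * p := by
      simp only [hpw', mul_add, add_mul, one_mul, mul_assoc]; abel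
    rw [e, mul_sub, hθ', hθ]
    simp only [hpw', mul_add, add_mul, one_mul, mul_assoc]; abel
  simp only [add_mul, sub_mul, mul_assoc, smul_mul_assoc, hsq, hθ] at h
  simp only [mul_add, mul_sub, mul_smul_comm, hθ']
  linear_combination (norm := module) -h

/-- In an algebra where `x, p` and `y, q` satisfy the Weyl relations and `x - y` is left
cancellable, the first-order intertwining relation together with `R y = y R` implies the
second-order one. -/
lemma intertwines_laxMatrix_mul {u₁ u₂ v₁ v₂ : ℂ}
    (hw : ∀ a b : A, (x - y) * a = (x - y) * b → a = b)
    (hxy : x * y = y * x) (hqp : q * p = p * q) (hpx : p * x = x * p + 1)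
    (hqy : q * y = y * q + 1) (hpy : p * y = y * p) (hqx : q * x = x * q)
    (hz : R * y = y * R)
    (hL : ∀ i j, R * (laxMatrix x p u₁ u₂ + laxMatrix y q v₁ v₂) i j =
      (laxMatrix x p u₁ v₂ + laxMatrix y q v₁ u₂) i j * R) (i j : Fin 2) :
    R * (laxMatrix x p u₁ u₂ * laxMatrix y q v₁ v₂) i j =
      (laxMatrix x p u₁ v₂ * laxMatrix y q v₁ u₂) i j * R := by
  obtain ⟨w, rfl⟩ : ∃ w, x = w + y := ⟨x - y, (sub_add_cancel x y).symm⟩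
  obtain ⟨S, rfl⟩ : ∃ S, q = S - p := ⟨q + p, (add_sub_cancel_right q p).symm⟩
  rw [add_sub_cancel_right] at hw
  have hpw : p * w = w * p + 1 := by
    simp only [mul_add, add_mul, hpy] at hpx
    linear_combination (norm := module) hpx
  have hwy : w * y = y * w := by
    simpa only [mul_add, add_mul, add_left_inj] using hxy
  have hSp : S * p = p * S := by
    simpa only [mul_sub, sub_mul, sub_left_inj] using hqp
  have hSy : S * y = y * S + 1 := by
    simp only [mul_sub, sub_mul, hpy] at hqy
    linear_combination (norm := module) hqy
  have hSw : S * w = w * S := by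
    simp only [mul_add, add_mul, mul_sub, sub_mul, hpy, hpw, hSy] at hqx
    linear_combination (norm := module) hqx
  have ha := hL 0 0
  have hb := hL 0 1
  have hc := hL 1 0
  simp only [laxMatrix, Matrix.add_apply, Matrix.mul_apply, Fin.sum_univ_two, Matrix.of_apply,
    Matrix.cons_val', Matrix.cons_val_zero, Matrix.cons_val_one, Matrix.cons_val_fin_one]
    at ha hb hc ⊢
  have hS : R * S = S * R := by
    simp only [mul_add, add_mul, mul_sub, sub_mul, mul_neg, neg_mul] at hb
    linear_combination (norm := module) -hb
  have hz' := mul_mul_eq_of_mul_eq hz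
  have hS' := mul_mul_eq_of_mul_eq hS
  have hpy' := mul_mul_eq_of_mul_eq hpy
  have hwy' := mul_mul_eq_of_mul_eq hwy
  have hSw' := mul_mul_eq_of_mul_eq hSw.symm
  have hθ : R * (w * p) = w * (p * R) := by
    simp only [mul_add, add_mul, mul_sub, sub_mul, mul_assoc, smul_mul_assoc, mul_smul_comm,
      mul_one, one_mul, hz', hS] at ha
    linear_combination (norm := module) ha
  have hθ' : ∀ t, R * (w * (p * t)) = w * (p * (R * t)) := fun t => by
    simpa only [mul_assoc] using congrArg (· * t) hθ
  have hC : R * (w * (w * p)) =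
      w * (w * (p * R)) + (u₁ - v₂) • (w * R) - (u₁ - u₂) • (R * w) := by
    simp only [mul_add, add_mul, mul_sub, sub_mul, mul_assoc, smul_mul_assoc, mul_smul_comm,
      hz, hz', hS, hwy, hθ, smul_add] at hc
    linear_combination (norm := module) hc
  have hD := lowering_of_raising hw hpw hθ hC
  rw [hθ'] at hD
  have hC' : ∀ t, R * (w * (w * (p * t))) = w * (w * (p * (R * t))) +
      (u₁ - v₂) • (w * (R * t)) - (u₁ - u₂) • (R * (w * t)) := fun t => by
    simpa only [mul_assoc, add_mul, sub_mul, smul_mul_assoc] using congrArg (· * t) hC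
  fin_cases i <;> fin_cases j <;>
  · simp only [Fin.zero_eta, Fin.mk_one, Matrix.cons_val_zero, Matrix.cons_val_one,
      Matrix.cons_val_fin_one, mul_add, add_mul, mul_sub, sub_mul, mul_neg, neg_mul, mul_assoc,
      smul_mul_assoc, mul_smul_comm, mul_one, one_mul, smul_add, smul_sub,
      hz, hz', hS, hS', hpy, hpy', hwy, hwy', ← hSw, hSw', ← hSp,
      hθ, hθ', hC, hC', hD]
    module

end Intertwiner

/-- If `R` commutes with multiplication by `z₂` and satisfies the first-order system
`R (L₁(u₁,u₂) + L₂(v₁,v₂)) = (L₁(u₁,v₂) + L₂(v₁,u₂)) R`, then `R` satisfies the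
second-order defining equation `R L₁(u₁,u₂) L₂(v₁,v₂) = L₁(u₁,v₂) L₂(v₁,u₂) R`. -/
theorem R2_first_order_implies_second_order (u₁ u₂ v₁ v₂ : ℂ)
    (R : Module.End ℂ (MvPolynomial (Fin 2) ℂ))
    (hz : R * Zm 1 = Zm 1 * R)
    (hL : SM R * (Lax 0 u₁ u₂ + Lax 1 v₁ v₂) = (Lax 0 u₁ v₂ + Lax 1 v₁ u₂) * SM R) :
    SM R * (Lax 0 u₁ u₂ * Lax 1 v₁ v₂) = Lax 0 u₁ v₂ * Lax 1 v₁ u₂ * SM R := by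
  ext1 i j
  rw [SM_mul_apply, mul_SM_apply]
  refine intertwines_laxMatrix_mul (fun _ _ => Zm_sub_mul_cancel) (Zm_mul_comm 0 1)
    (Dm_mul_comm 1 0) (Dm_mul_Zm_self 0) (Dm_mul_Zm_self 1) (Dm_mul_Zm_of_ne zero_ne_one)
    (Dm_mul_Zm_of_ne one_ne_zero) hz (fun k l => ?_) i j
  have h := congrFun (congrFun hL k) l
  rwa [SM_mul_apply, mul_SM_apply] at h
end

section
/- Let u₁, u₂, v₁, v₂ ∈ ℂ with u₁−v₂ ∉ ℤ_{≤0} and u₁−u₂ ∉ ℤ_{≤0}. Suppose R is a ℂ-linear endomorphism of ℂ[z₁,z₂] such that R commutes with multiplication by z₂ and R (L₁(u₁,u₂) + L₂(v₁,v₂)) = (L₁(u₁,v₂) + L₂(v₁,u₂)) R as 2×2 matrices of operators. Then there exists a constant c ∈ ℂ such that R = c · D₁[u₁−v₂, u₁−u₂], where D₁[α,β](z₂ʲ(z₁−z₂)ᵏ) = (Γ(k+α)/Γ(k+β)) z₂ʲ(z₁−z₂)ᵏ; that is, the defining system fixes the operator ℛ₂ up to overall normalization. -/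
open MvPolynomial

/-- A polynomial over a domain of characteristic zero
all of whose partial derivatives vanish is constant. -/
theorem MvPolynomial.exists_eq_C_of_pderiv_eq_zero {σ K : Type*} [CommRing K] [IsDomain K]
    [CharZero K] {q : MvPolynomial σ K} (h : ∀ i, pderiv i q = 0) : ∃ c, q = C c := by
  classical
  refine ⟨coeff 0 q, ?_⟩
  ext m
  rw [coeff_C]
  split_ifs with hm
  · rw [hm]
  · obtain ⟨i, hi⟩ : ∃ i, m i ≠ 0 := by
      by_contra! H
      exact hm (Finsupp.ext fun i => (H i).symm)
    have h0 := congrArg (coeff (m - Finsupp.single i 1)) (h i)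
    have hle : Finsupp.single i 1 ≤ m := by
      rw [Finsupp.single_le_iff]
      omega
    rw [coeff_pderiv, tsub_add_cancel_of_le hle, coeff_zero, mul_eq_zero] at h0
    refine h0.resolve_right ?_
    norm_cast

/-- A translation-invariant polynomial `q(z₁, z₂)` with `(z₁ - z₂) ∂₁ q = k q` is a multiple of
`(z₁ - z₂)ᵏ`. -/
theorem exists_eq_smul_sub_pow (k : ℕ) :
    ∀ q : MvPolynomial (Fin 2) ℂ, pderiv 0 q + pderiv 1 q = 0 →
      (X 0 - X 1) * pderiv 0 q = (k : ℂ) • q → ∃ c : ℂ, q = c • (X 0 - X 1) ^ k := by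
  have hX : (X 0 - X 1 : MvPolynomial (Fin 2) ℂ) ≠ 0 :=
    sub_ne_zero.2 fun h => absurd (X_injective h) (by decide)
  induction k with
  | zero =>
    intro q hT hE
    have h0 : pderiv 0 q = 0 := by simpa [hX] using hE
    have h1 : pderiv 1 q = 0 := by simpa [h0] using hT
    obtain ⟨c, rfl⟩ := exists_eq_C_of_pderiv_eq_zero (q := q) (Fin.forall_fin_two.2 ⟨h0, h1⟩)
    exact ⟨c, by simp [smul_eq_C_mul]⟩
  | succ k ih =>
    intro q hT hE
    have hE' : (X 0 - X 1) * pderiv 0 (pderiv 0 q) = (k : ℂ) • pderiv 0 q := by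
      have h := congrArg (pderiv 0) hE
      simp only [Derivation.leibniz, map_sub, pderiv_X_self, smul_eq_mul, Derivation.map_smul,
        pderiv_X_of_ne (show (1 : Fin 2) ≠ 0 by decide)] at h
      push_cast at h
      rw [add_smul, one_smul] at h
      linear_combination h
    have hT' : pderiv 0 (pderiv 0 q) + pderiv 1 (pderiv 0 q) = 0 := by
      have h := congrArg (pderiv 1) hE
      simp only [Derivation.leibniz, map_sub, pderiv_X_self, smul_eq_mul, Derivation.map_smul,
        pderiv_X_of_ne (show (0 : Fin 2) ≠ 1 by decide), eq_neg_of_add_eq_zero_right hT] at h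
      push_cast at h
      rw [add_smul, one_smul, smul_neg] at h
      refine (mul_eq_zero.1 ?_).resolve_left hX
      linear_combination h + hE'
    obtain ⟨c, hc⟩ := ih _ hT' hE'
    have hk : ((k + 1 : ℕ) : ℂ) ≠ 0 := by exact_mod_cast k.succ_ne_zero
    refine ⟨((k + 1 : ℕ) : ℂ)⁻¹ * c, ?_⟩
    rw [mul_smul, eq_inv_smul_iff₀ hk, ← hE, hc, mul_smul_comm, pow_succ']

/-- If `R` commutes with multiplication by `z₂` and satisfies
`R (L₁(u₁,u₂) + L₂(v₁,v₂)) = (L₁(u₁,v₂) + L₂(v₁,u₂)) R`, then `R` is a constant multiple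
of `D₁[u₁−v₂, u₁−u₂]`, i.e. `∃ c, R = c·D₁[u₁−v₂,u₁−u₂]`, equality being recorded on the
basis `z₂ʲ(z₁−z₂)ᵏ` of `ℂ[z₁,z₂]`: the defining system fixes `ℛ₂` up to normalization. -/
theorem R2_uniqueness (u₁ u₂ v₁ v₂ : ℂ)
    (h₁ : ∀ n : ℕ, u₁ - v₂ ≠ -(n : ℂ)) (h₂ : ∀ n : ℕ, u₁ - u₂ ≠ -(n : ℂ))
    (R : Module.End ℂ (MvPolynomial (Fin 2) ℂ))
    (hz : R * Zm 1 = Zm 1 * R)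
    (hL : SM R * (Lax 0 u₁ u₂ + Lax 1 v₁ v₂) = (Lax 0 u₁ v₂ + Lax 1 v₁ u₂) * SM R) :
    ∃ c : ℂ, ∀ j k : ℕ,
      R ((X 1) ^ j * (X 0 - X 1) ^ k)
        = (c * (Complex.Gamma ((k : ℂ) + (u₁ - v₂)) / Complex.Gamma ((k : ℂ) + (u₁ - u₂))))
            • ((X 1) ^ j * (X 0 - X 1) ^ k) := by
  have hX : (X 0 - X 1 : MvPolynomial (Fin 2) ℂ) ≠ 0 :=
    sub_ne_zero.2 fun h => absurd (X_injective h) (by decide)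
  have hentry (a b : Fin 2) (p : MvPolynomial (Fin 2) ℂ) :=
    LinearMap.congr_fun (congrFun (congrFun hL a) b) p
  have hT (p : MvPolynomial (Fin 2) ℂ) :
      R (pderiv 0 p + pderiv 1 p) = pderiv 0 (R p) + pderiv 1 (R p) := by
    have h := hentry 0 1 p
    simp [SM, Lax, Dm] at h
    rw [map_add]
    linear_combination -h
  have hE (p : MvPolynomial (Fin 2) ℂ) :
      R (X 0 * pderiv 0 p + X 1 * pderiv 1 p) =
        X 0 * pderiv 0 (R p) + X 1 * pderiv 1 (R p) := by
    have h := hentry 0 0 p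
    simp [SM, Lax, Dm, Zm] at h
    rw [map_add]
    linear_combination h
  have hS (p : MvPolynomial (Fin 2) ℂ) :
      R (X 0 * X 0 * pderiv 0 p + (u₁ - u₂) • (X 0 * p)
          + (X 1 * X 1 * pderiv 1 p + (v₁ - v₂) • (X 1 * p))) =
        X 0 * X 0 * pderiv 0 (R p) + (u₁ - v₂) • (X 0 * R p)
          + (X 1 * X 1 * pderiv 1 (R p) + (v₁ - u₂) • (X 1 * R p)) := by
    have h := hentry 1 0 p
    simpa [SM, Lax, Dm, Zm, mul_assoc] using h
  have hR (p : MvPolynomial (Fin 2) ℂ) : R (X 1 * p) = X 1 * R p :=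
    LinearMap.congr_fun hz p
  have hd0 (k : ℕ) : (X 0 - X 1) * pderiv 0 ((X 0 - X 1 : MvPolynomial (Fin 2) ℂ) ^ k) =
      (k : ℂ) • (X 0 - X 1) ^ k := by
    cases k with
    | zero => simp
    | succ k =>
      rw [pderiv_pow, map_sub, pderiv_X_self, pderiv_X_of_ne (show (1 : Fin 2) ≠ 0 by decide),
        Nat.add_sub_cancel, smul_eq_C_mul, map_natCast]
      ring
  have hd1 (k : ℕ) : pderiv 1 ((X 0 - X 1 : MvPolynomial (Fin 2) ℂ) ^ k) =
      -pderiv 0 ((X 0 - X 1 : MvPolynomial (Fin 2) ℂ) ^ k) := by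
    simp [Derivation.leibniz_pow, pderiv_X_of_ne (show (1 : Fin 2) ≠ 0 by decide),
      pderiv_X_of_ne (show (0 : Fin 2) ≠ 1 by decide)]
  have hdiag (k : ℕ) : ∃ c : ℂ, R ((X 0 - X 1) ^ k) = c • (X 0 - X 1) ^ k := by
    have hTk := hT ((X 0 - X 1) ^ k)
    have hEk := hE ((X 0 - X 1) ^ k)
    rw [hd1, add_neg_cancel, map_zero] at hTk
    rw [hd1, mul_neg, ← sub_eq_add_neg, ← sub_mul, hd0, map_smul] at hEk
    refine exists_eq_smul_sub_pow k _ hTk.symm ?_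
    linear_combination -hEk + X 1 * hTk
  choose r hr using hdiag
  have hrec (k : ℕ) : r (k + 1) * (k + (u₁ - u₂)) = r k * (k + (u₁ - v₂)) := by
    have h := hS ((X 0 - X 1) ^ k)
    have hl (a b : ℂ) : X 0 * X 0 * pderiv 0 ((X 0 - X 1) ^ k) + a • (X 0 * (X 0 - X 1) ^ k)
          + (X 1 * X 1 * pderiv 1 ((X 0 - X 1) ^ k) + b • (X 1 * (X 0 - X 1) ^ k)) =
        (k + a) • (X 0 - X 1 : MvPolynomial (Fin 2) ℂ) ^ (k + 1)
          + (2 * k + a + b) • (X 1 * (X 0 - X 1) ^ k) := by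
      have h0 := hd0 k
      rw [hd1]
      simp only [smul_eq_C_mul, map_add, map_mul, map_ofNat] at h0 ⊢
      linear_combination (X 0 + X 1) * h0
    have hrhs : X 0 * X 0 * pderiv 0 (R ((X 0 - X 1) ^ k))
          + (u₁ - v₂) • (X 0 * R ((X 0 - X 1) ^ k))
          + (X 1 * X 1 * pderiv 1 (R ((X 0 - X 1) ^ k))
          + (v₁ - u₂) • (X 1 * R ((X 0 - X 1) ^ k))) =
        r k • ((k + (u₁ - v₂)) • (X 0 - X 1 : MvPolynomial (Fin 2) ℂ) ^ (k + 1)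
          + (2 * k + (u₁ - v₂) + (v₁ - u₂)) • (X 1 * (X 0 - X 1) ^ k)) := by
      rw [← hl, hr]
      simp only [smul_eq_C_mul, pderiv_C_mul]
      ring
    rw [hl, hrhs, map_add, map_smul, map_smul, hR, hr, hr] at h
    have h' : (r (k + 1) * (k + (u₁ - u₂)) - r k * (k + (u₁ - v₂))) •
        (X 0 - X 1 : MvPolynomial (Fin 2) ℂ) ^ (k + 1) = 0 := by
      simp only [smul_eq_C_mul, map_add, map_sub, map_mul, map_ofNat] at h ⊢
      linear_combination h
    exact sub_eq_zero.1 ((smul_eq_zero.1 h').resolve_right (pow_ne_zero _ hX))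
  have hα (k : ℕ) : (k : ℂ) + (u₁ - v₂) ≠ 0 := fun h => h₁ k (by linear_combination h)
  have hβ (k : ℕ) : (k : ℂ) + (u₁ - u₂) ≠ 0 := fun h => h₂ k (by linear_combination h)
  have hΓα : Complex.Gamma (u₁ - v₂) ≠ 0 := Complex.Gamma_ne_zero h₁
  have hΓβ : Complex.Gamma (u₁ - u₂) ≠ 0 := Complex.Gamma_ne_zero h₂
  refine ⟨r 0 * (Complex.Gamma (u₁ - u₂) / Complex.Gamma (u₁ - v₂)), fun j k => ?_⟩
  have hrk : r k = r 0 * (Complex.Gamma (u₁ - u₂) / Complex.Gamma (u₁ - v₂)) *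
      (Complex.Gamma (k + (u₁ - v₂)) / Complex.Gamma (k + (u₁ - u₂))) := by
    induction k with
    | zero =>
      simp only [Nat.cast_zero, zero_add]
      field_simp
    | succ k ih =>
      rw [eq_div_of_mul_eq (hβ k) (hrec k), ih, Nat.cast_succ, add_right_comm _ 1,
        add_right_comm _ 1, Complex.Gamma_add_one _ (hα k), Complex.Gamma_add_one _ (hβ k)]
      simp only [div_eq_mul_inv, mul_inv]
      ring
  rw [← hrk]
  induction j with
  | zero => simpa using hr k
  | succ j ih => rw [pow_succ', mul_assoc, hR, ih, mul_smul_comm]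
end

section
/- Let u₁, u₂, u₃, v₃ ∈ ℂ be such that u₂−v₃, u₁−v₃ and u₁−u₃ are not integers. On the Laurent-polynomial ring A = ℂ[x,y,z,z⁻¹] with ℂ-basis {xⁱyʲzᵏ : i,j ∈ ℕ, k ∈ ℤ}, define the diagonal operators a(xⁱyʲzᵏ) = (Γ(k+u₂−v₃+1)/Γ(k+1))·xⁱyʲzᵏ (interpreted via the entire function 1/Γ, so the coefficient is 0 when k < 0) and b(xⁱyʲzᵏ) = (Γ(j+u₁−v₃+1)/Γ(j+u₁−u₃+1))·xⁱyʲzᵏ, and on ℂ[x,y,z] the diagonal operator c(xⁱyʲzᵏ) = (Γ(k+1)/Γ(k+u₂−u₃+1))·xⁱyʲzᵏ (k ∈ ℕ); let σ be the ℂ-algebra automorphism of A with σ(x) = x + y/z, σ(y) = y, σ(z) = z. Then the operator r = a ∘ σ ∘ b ∘ σ⁻¹ ∘ c : ℂ[x,y,z] → A satisfies the defining system of the sl(3) operator ℛ₃: (i) r(x∂ₓ+y∂_y) = (x∂ₓ+y∂_y)r; (ii) r∂ₓ = ∂ₓ r; (iii) r(−x∂ₓ+z∂_z) = (−x∂ₓ+z∂_z)r;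 (iv) r(y∂ₓ + z²∂_z + (u₂−u₃+1)z) = (y∂ₓ + z²∂_z + (u₂−v₃+1)z) r; (v) r(x²∂ₓ + xy∂_y − xz∂_z − y∂_z + (u₁−u₂+1)x) = (x²∂ₓ + xy∂_y − xz∂_z − y∂_z + (u₁−u₂+1)x) r; (vi) r(x(y∂ₓ+z²∂_z+(u₂−u₃+1)z) + y(y∂_y+z∂_z+u₁−u₃+2)) = (x(y∂ₓ+z²∂_z+(u₂−v₃+1)z) + y(y∂_y+z∂_z+u₁−v₃+2)) r, where in each identity the operator on the right of r is the restriction to ℂ[x,y,z] (which each of these differential operators preserves) and the operator on the left acts on A. -/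
/-- The Laurent-polynomial ring `A = ℂ[x,y,z,z⁻¹]`, realized as the free `ℂ`-module on
the monomial basis `{xⁱyʲzᵏ : i,j ∈ ℕ, k ∈ ℤ}`. -/
abbrev A19 : Type := (ℕ × ℕ × ℤ) →₀ ℂ

/-- The basis monomial `xⁱyʲzᵏ`. -/
noncomputable def e19 (p : ℕ × ℕ × ℤ) : A19 := Finsupp.single p 1

/-- The linear operator determined by its values on the monomial basis. -/
noncomputable def mkOp (f : ℕ × ℕ × ℤ → A19) : Module.End ℂ A19 :=
  Finsupp.lsum ℂ fun p => LinearMap.toSpanSingleton ℂ A19 (f p)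

/-- Multiplication by `x`. -/
noncomputable def mx : Module.End ℂ A19 := mkOp fun p => e19 (p.1 + 1, p.2.1, p.2.2)

/-- Multiplication by `y`. -/
noncomputable def my : Module.End ℂ A19 := mkOp fun p => e19 (p.1, p.2.1 + 1, p.2.2)

/-- Multiplication by `z`. -/
noncomputable def mz : Module.End ℂ A19 := mkOp fun p => e19 (p.1, p.2.1, p.2.2 + 1)

/-- The derivation `∂ₓ`: `xⁱyʲzᵏ ↦ i·xⁱ⁻¹yʲzᵏ`. -/
noncomputable def dx : Module.End ℂ A19 :=
  mkOp fun p => (p.1 : ℂ) • e19 (p.1 - 1, p.2.1, p.2.2)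

/-- The derivation `∂_y`: `xⁱyʲzᵏ ↦ j·xⁱyʲ⁻¹zᵏ`. -/
noncomputable def dy : Module.End ℂ A19 :=
  mkOp fun p => (p.2.1 : ℂ) • e19 (p.1, p.2.1 - 1, p.2.2)

/-- The derivation `∂_z`: `xⁱyʲzᵏ ↦ k·xⁱyʲzᵏ⁻¹`. -/
noncomputable def dz : Module.End ℂ A19 :=
  mkOp fun p => (p.2.2 : ℂ) • e19 (p.1, p.2.1, p.2.2 - 1)

/-- The `ℂ`-algebra automorphism `σ` of `A` with `σ(x) = x + y/z`, `σ(y) = y`,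
`σ(z) = z`: on monomials, `σ(xⁱyʲzᵏ) = (x+y/z)ⁱyʲzᵏ = ∑_t C(i,t) xⁱ⁻ᵗ yʲ⁺ᵗ zᵏ⁻ᵗ`. -/
noncomputable def sig19 : Module.End ℂ A19 :=
  mkOp fun p => ∑ t ∈ Finset.range (p.1 + 1),
    ((p.1.choose t : ℕ) : ℂ) • e19 (p.1 - t, p.2.1 + t, p.2.2 - (t : ℤ))

/-- The inverse automorphism `σ⁻¹`, with `σ⁻¹(x) = x − y/z`: on monomials,
`σ⁻¹(xⁱyʲzᵏ) = (x−y/z)ⁱyʲzᵏ = ∑_t (−1)ᵗ C(i,t) xⁱ⁻ᵗ yʲ⁺ᵗ zᵏ⁻ᵗ`. -/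
noncomputable def sig19inv : Module.End ℂ A19 :=
  mkOp fun p => ∑ t ∈ Finset.range (p.1 + 1),
    ((-1 : ℂ) ^ t * ((p.1.choose t : ℕ) : ℂ)) • e19 (p.1 - t, p.2.1 + t, p.2.2 - (t : ℤ))

/-- The diagonal operator `a`: `xⁱyʲzᵏ ↦ (Γ(k+u₂−v₃+1)/Γ(k+1))·xⁱyʲzᵏ` (the coefficient
vanishes for `k < 0` since Mathlib's `Γ` vanishes at nonpositive integers, matching the
interpretation via the entire function `1/Γ`). -/
noncomputable def aop (u₂ v₃ : ℂ) : Module.End ℂ A19 :=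
  mkOp fun p =>
    (Complex.Gamma ((p.2.2 : ℂ) + (u₂ - v₃) + 1) / Complex.Gamma ((p.2.2 : ℂ) + 1)) • e19 p

/-- The diagonal operator `b`: `xⁱyʲzᵏ ↦ (Γ(j+u₁−v₃+1)/Γ(j+u₁−u₃+1))·xⁱyʲzᵏ`. -/
noncomputable def bop (u₁ u₃ v₃ : ℂ) : Module.End ℂ A19 :=
  mkOp fun p =>
    (Complex.Gamma ((p.2.1 : ℂ) + (u₁ - v₃) + 1) /
      Complex.Gamma ((p.2.1 : ℂ) + (u₁ - u₃) + 1)) • e19 p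

/-- The diagonal operator `c`: `xⁱyʲzᵏ ↦ (Γ(k+1)/Γ(k+u₂−u₃+1))·xⁱyʲzᵏ`. -/
noncomputable def cop (u₂ u₃ : ℂ) : Module.End ℂ A19 :=
  mkOp fun p =>
    (Complex.Gamma ((p.2.2 : ℂ) + 1) / Complex.Gamma ((p.2.2 : ℂ) + (u₂ - u₃) + 1)) • e19 p

/-- The operator `r = a ∘ σ ∘ b ∘ σ⁻¹ ∘ c`. -/
noncomputable def rop (u₁ u₂ u₃ v₃ : ℂ) : Module.End ℂ A19 :=
  aop u₂ v₃ * sig19 * bop u₁ u₃ v₃ * sig19inv * cop u₂ u₃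

/-! ### Operators on the monomial basis -/

theorem mkOp_e19 (f : ℕ × ℕ × ℤ → A19) (p : ℕ × ℕ × ℤ) : mkOp f (e19 p) = f p := by
  simp [mkOp, e19]

/-- Linear operators on `A` agreeing on monomials agree everywhere. -/
theorem A19_end_ext {f g : Module.End ℂ A19}
    (h : ∀ (i j : ℕ) (k : ℤ), f (e19 (i, j, k)) = g (e19 (i, j, k))) (v : A19) : f v = g v := by
  have : f = g := Finsupp.lhom_ext' fun p => LinearMap.ext_ring (h p.1 p.2.1 p.2.2)
  rw [this]

section Monomials

variable (i j : ℕ) (k : ℤ)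

theorem mx_e19 : mx (e19 (i, j, k)) = e19 (i + 1, j, k) := mkOp_e19 _ _

theorem my_e19 : my (e19 (i, j, k)) = e19 (i, j + 1, k) := mkOp_e19 _ _

theorem mz_e19 : mz (e19 (i, j, k)) = e19 (i, j, k + 1) := mkOp_e19 _ _

theorem dx_e19 : dx (e19 (i, j, k)) = (i : ℂ) • e19 (i - 1, j, k) := mkOp_e19 _ _

theorem dy_e19 : dy (e19 (i, j, k)) = (j : ℂ) • e19 (i, j - 1, k) := mkOp_e19 _ _

theorem dz_e19 : dz (e19 (i, j, k)) = (k : ℂ) • e19 (i, j, k - 1) := mkOp_e19 _ _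

end Monomials

/-- Multiplication by `z⁻¹`. -/
noncomputable def mzInv : Module.End ℂ A19 := mkOp fun p => e19 (p.1, p.2.1, p.2.2 - 1)

theorem mzInv_e19 (i j : ℕ) (k : ℤ) : mzInv (e19 (i, j, k)) = e19 (i, j, k - 1) := mkOp_e19 _ _

/-! ### Weyl algebra relations -/

section Weyl

variable (v : A19)

theorem my_mx : my (mx v) = mx (my v) :=
  A19_end_ext (f := my * mx) (g := mx * my) (fun i j k => by simp [mx_e19, my_e19]) v

theorem mz_my : mz (my v) = my (mz v) :=
  A19_end_ext (f := mz * my) (g := my * mz) (fun i j k => by simp [my_e19, mz_e19]) v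

theorem mzInv_mx : mzInv (mx v) = mx (mzInv v) :=
  A19_end_ext (f := mzInv * mx) (g := mx * mzInv) (fun i j k => by simp [mx_e19, mzInv_e19]) v

theorem mzInv_my : mzInv (my v) = my (mzInv v) :=
  A19_end_ext (f := mzInv * my) (g := my * mzInv) (fun i j k => by simp [my_e19, mzInv_e19]) v

theorem mz_mzInv : mz (mzInv v) = v :=
  A19_end_ext (f := mz * mzInv) (g := 1) (fun i j k => by simp [mz_e19, mzInv_e19]) v

theorem mzInv_mz : mzInv (mz v) = v :=
  A19_end_ext (f := mzInv * mz) (g := 1) (fun i j k => by simp [mz_e19, mzInv_e19]) v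

theorem dx_mx : dx (mx v) = mx (dx v) + v :=
  A19_end_ext (f := dx * mx) (g := mx * dx + 1) (fun i j k => by
    cases i <;> simp [mx_e19, dx_e19, add_smul]) v

theorem dx_my : dx (my v) = my (dx v) :=
  A19_end_ext (f := dx * my) (g := my * dx) (fun i j k => by simp [my_e19, dx_e19]) v

theorem dx_mzInv : dx (mzInv v) = mzInv (dx v) :=
  A19_end_ext (f := dx * mzInv) (g := mzInv * dx) (fun i j k => by simp [mzInv_e19, dx_e19]) v

theorem dy_mx : dy (mx v) = mx (dy v) :=
  A19_end_ext (f := dy * mx) (g := mx * dy) (fun i j k => by simp [mx_e19, dy_e19]) v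

theorem dy_my : dy (my v) = my (dy v) + v :=
  A19_end_ext (f := dy * my) (g := my * dy + 1) (fun i j k => by
    cases j <;> simp [my_e19, dy_e19, add_smul]) v

theorem dy_mzInv : dy (mzInv v) = mzInv (dy v) :=
  A19_end_ext (f := dy * mzInv) (g := mzInv * dy) (fun i j k => by simp [mzInv_e19, dy_e19]) v

theorem dz_mx : dz (mx v) = mx (dz v) :=
  A19_end_ext (f := dz * mx) (g := mx * dz) (fun i j k => by simp [mx_e19, dz_e19]) v

theorem dz_my : dz (my v) = my (dz v) :=
  A19_end_ext (f := dz * my) (g := my * dz) (fun i j k => by simp [my_e19, dz_e19]) v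

theorem dz_mzInv : dz (mzInv v) = mzInv (dz v) - mzInv (mzInv v) :=
  A19_end_ext (f := dz * mzInv) (g := mzInv * dz - mzInv * mzInv) (fun i j k => by
    simp [mzInv_e19, dz_e19, sub_smul]) v

end Weyl

/-! ### The shears `x ↦ x + ε y/z` -/

/-- The algebra endomorphism `x ↦ x + ε y/z`, `y ↦ y`, `z ↦ z`. -/
noncomputable def shear (ε : ℂ) : Module.End ℂ A19 :=
  mkOp fun p => ∑ t ∈ Finset.range (p.1 + 1),
    (ε ^ t * ((p.1.choose t : ℕ) : ℂ)) • e19 (p.1 - t, p.2.1 + t, p.2.2 - (t : ℤ))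

theorem sig19_eq_shear : sig19 = shear 1 := by
  simp [sig19, shear]

theorem sig19inv_eq_shear : sig19inv = shear (-1) := rfl

section Shear

variable (ε : ℂ)

theorem shear_e19 (i j : ℕ) (k : ℤ) : shear ε (e19 (i, j, k)) =
    ∑ t ∈ Finset.range (i + 1), (ε ^ t * (i.choose t : ℂ)) • e19 (i - t, j + t, k - (t : ℤ)) :=
  mkOp_e19 _ _

theorem shear_e19_zero (j : ℕ) (k : ℤ) : shear ε (e19 (0, j, k)) = e19 (0, j, k) := by
  simp [shear_e19]

variable (v : A19)

theorem shear_my : shear ε (my v) = my (shear ε v) :=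
  A19_end_ext (f := shear ε * my) (g := my * shear ε) (fun i j k => by
    simp [my_e19, shear_e19, add_right_comm]) v

theorem shear_mz : shear ε (mz v) = mz (shear ε v) :=
  A19_end_ext (f := shear ε * mz) (g := mz * shear ε) (fun i j k => by
    simp [mz_e19, shear_e19, sub_add_eq_add_sub]) v

theorem shear_mzInv : shear ε (mzInv v) = mzInv (shear ε v) :=
  A19_end_ext (f := shear ε * mzInv) (g := mzInv * shear ε) (fun i j k => by
    simp [mzInv_e19, shear_e19, sub_right_comm]) v

theorem shear_mx : shear ε (mx v) = mx (shear ε v) + ε • my (mzInv (shear ε v)) := by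
  refine A19_end_ext (f := shear ε * mx) (g := mx * shear ε + ε • (my * mzInv * shear ε))
    (fun i j k => ?_) v
  simp only [Module.End.mul_apply, LinearMap.add_apply, LinearMap.smul_apply, mx_e19, shear_e19,
    map_sum, map_smul, mzInv_e19, my_e19, Finset.smul_sum]
  rw [Finset.sum_range_succ' _ (i + 1), Finset.sum_range_succ'
    (fun t => (ε ^ t * (i.choose t : ℂ)) • e19 (i - t + 1, j + t, k - (t : ℤ))) i]
  have hlast : ∑ t ∈ Finset.range i, (ε ^ (t + 1) * (i.choose (t + 1) : ℂ)) •
        e19 (i - (t + 1) + 1, j + (t + 1), k - ((t + 1 : ℕ) : ℤ)) =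
      ∑ t ∈ Finset.range (i + 1), (ε ^ (t + 1) * (i.choose (t + 1) : ℂ)) •
        e19 (i - t, j + (t + 1), k - ((t + 1 : ℕ) : ℤ)) := by
    rw [Finset.sum_range_succ]
    simp only [Nat.choose_succ_self, Nat.cast_zero, mul_zero, zero_smul, add_zero]
    refine Finset.sum_congr rfl fun t ht => ?_
    rw [show i - (t + 1) + 1 = i - t by have := Finset.mem_range.1 ht; omega]
  rw [hlast, add_right_comm, ← Finset.sum_add_distrib]
  congr 1
  · refine Finset.sum_congr rfl fun t _ => ?_
    rw [show k - (t : ℤ) - 1 = k - ((t + 1 : ℕ) : ℤ) by push_cast; ring,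
      show i + 1 - (t + 1) = i - t by omega, Nat.choose_succ_succ, add_assoc j t 1, smul_smul,
      ← add_smul]
    congr 1
    push_cast
    ring
  · simp

/-- Two operators agreeing on `yʲzᵏ` and transforming in the same way under multiplication by
`x` are equal. -/
theorem A19_end_ext_mx {f g : Module.End ℂ A19}
    (h0 : ∀ (j : ℕ) (k : ℤ), f (e19 (0, j, k)) = g (e19 (0, j, k)))
    (hx : ∀ w, f w = g w → f (mx w) = g (mx w)) (v : A19) : f v = g v := by
  refine A19_end_ext (fun i j k => ?_) v
  induction i with
  | zero => exact h0 j k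
  | succ i ih => rw [← mx_e19]; exact hx _ ih

theorem shear_dx : shear ε (dx v) = dx (shear ε v) := by
  refine A19_end_ext_mx (f := shear ε * dx) (g := dx * shear ε) (fun j k => ?_)
    (fun w hw => ?_) v
  · simp [dx_e19, shear_e19_zero]
  · simp only [Module.End.mul_apply] at hw ⊢
    simp only [dx_mx, shear_mx, map_add, map_smul, hw, dx_my, dx_mzInv]
    module

theorem shear_dy : shear ε (dy v) = dy (shear ε v) - ε • mzInv (dx (shear ε v)) := by
  refine A19_end_ext_mx (f := shear ε * dy) (g := dy * shear ε - ε • (mzInv * dx * shear ε))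
    (fun j k => ?_) (fun w hw => ?_) v
  · simp [dx_e19, dy_e19, shear_e19_zero]
  · simp only [Module.End.mul_apply, LinearMap.sub_apply, LinearMap.smul_apply] at hw ⊢
    simp only [dy_mx, dx_mx, shear_mx, map_add, map_sub, map_smul, hw, dx_my, dx_mzInv, dy_my,
      mzInv_mx, mzInv_my, dy_mzInv]
    module

theorem shear_dz : shear ε (dz v) =
    dz (shear ε v) + ε • my (mzInv (mzInv (dx (shear ε v)))) := by
  refine A19_end_ext_mx (f := shear ε * dz)
    (g := dz * shear ε + ε • (my * mzInv * mzInv * dx * shear ε))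
    (fun j k => ?_) (fun w hw => ?_) v
  · simp [dx_e19, dz_e19, shear_e19_zero]
  · simp only [Module.End.mul_apply, LinearMap.add_apply, LinearMap.smul_apply] at hw ⊢
    simp only [dz_mx, dx_mx, shear_mx, map_add, map_sub, map_smul, hw, dx_my, dx_mzInv, dz_my,
      my_mx, mzInv_mx, mzInv_my, dz_mzInv]
    module

end Shear

/-! ### Diagonal operators -/

/-- The operator multiplying the monomial with exponent `p` by `g p`. -/
noncomputable def diagOp (g : ℕ × ℕ × ℤ → ℂ) : Module.End ℂ A19 := mkOp fun p => g p • e19 p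

theorem diagOp_e19 (g : ℕ × ℕ × ℤ → ℂ) (p : ℕ × ℕ × ℤ) : diagOp g (e19 p) = g p • e19 p :=
  mkOp_e19 _ _

section Diagonal

variable (v : A19)

theorem diagOp_mx_dx (g : ℕ × ℕ × ℤ → ℂ) : diagOp g (mx (dx v)) = mx (dx (diagOp g v)) :=
  A19_end_ext (f := diagOp g * (mx * dx)) (g := mx * dx * diagOp g) (fun i j k => by
    cases i <;> simp [dx_e19, mx_e19, diagOp_e19, smul_smul, mul_comm]) v

theorem diagOp_my_dy (g : ℕ × ℕ × ℤ → ℂ) : diagOp g (my (dy v)) = my (dy (diagOp g v)) :=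
  A19_end_ext (f := diagOp g * (my * dy)) (g := my * dy * diagOp g) (fun i j k => by
    cases j <;> simp [dy_e19, my_e19, diagOp_e19, smul_smul, mul_comm]) v

theorem diagOp_mz_dz (g : ℕ × ℕ × ℤ → ℂ) : diagOp g (mz (dz v)) = mz (dz (diagOp g v)) :=
  A19_end_ext (f := diagOp g * (mz * dz)) (g := mz * dz * diagOp g) (fun i j k => by
    simp [dz_e19, mz_e19, diagOp_e19, smul_smul, mul_comm]) v

variable (g : ℤ → ℂ) (h : ℕ → ℂ)

theorem diagOp_z_mx :
    diagOp (fun p => g p.2.2) (mx v) = mx (diagOp (fun p => g p.2.2) v) :=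
  A19_end_ext (f := diagOp (fun p => g p.2.2) * mx) (g := mx * diagOp fun p => g p.2.2)
    (fun i j k => by simp [mx_e19, diagOp_e19]) v

theorem diagOp_z_my :
    diagOp (fun p => g p.2.2) (my v) = my (diagOp (fun p => g p.2.2) v) :=
  A19_end_ext (f := diagOp (fun p => g p.2.2) * my) (g := my * diagOp fun p => g p.2.2)
    (fun i j k => by simp [my_e19, diagOp_e19]) v

theorem diagOp_z_dx :
    diagOp (fun p => g p.2.2) (dx v) = dx (diagOp (fun p => g p.2.2) v) :=
  A19_end_ext (f := diagOp (fun p => g p.2.2) * dx) (g := dx * diagOp fun p => g p.2.2)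
    (fun i j k => by simp [dx_e19, diagOp_e19, smul_smul, mul_comm]) v

theorem diagOp_y_mx :
    diagOp (fun p => h p.2.1) (mx v) = mx (diagOp (fun p => h p.2.1) v) :=
  A19_end_ext (f := diagOp (fun p => h p.2.1) * mx) (g := mx * diagOp fun p => h p.2.1)
    (fun i j k => by simp [mx_e19, diagOp_e19]) v

theorem diagOp_y_mz :
    diagOp (fun p => h p.2.1) (mz v) = mz (diagOp (fun p => h p.2.1) v) :=
  A19_end_ext (f := diagOp (fun p => h p.2.1) * mz) (g := mz * diagOp fun p => h p.2.1)
    (fun i j k => by simp [mz_e19, diagOp_e19]) v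

theorem diagOp_y_mzInv :
    diagOp (fun p => h p.2.1) (mzInv v) = mzInv (diagOp (fun p => h p.2.1) v) :=
  A19_end_ext (f := diagOp (fun p => h p.2.1) * mzInv) (g := mzInv * diagOp fun p => h p.2.1)
    (fun i j k => by simp [mzInv_e19, diagOp_e19]) v

theorem diagOp_y_dx :
    diagOp (fun p => h p.2.1) (dx v) = dx (diagOp (fun p => h p.2.1) v) :=
  A19_end_ext (f := diagOp (fun p => h p.2.1) * dx) (g := dx * diagOp fun p => h p.2.1)
    (fun i j k => by simp [dx_e19, diagOp_e19, smul_smul, mul_comm]) v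

theorem diagOp_y_dz :
    diagOp (fun p => h p.2.1) (dz v) = dz (diagOp (fun p => h p.2.1) v) :=
  A19_end_ext (f := diagOp (fun p => h p.2.1) * dz) (g := dz * diagOp fun p => h p.2.1)
    (fun i j k => by simp [dz_e19, diagOp_e19, smul_smul, mul_comm]) v

end Diagonal

/-! ### Gamma quotients -/

/-- The recurrence of `1/Γ`, valid at every point. -/
theorem mul_inv_Gamma_add_one (s : ℂ) :
    s * (Complex.Gamma (s + 1))⁻¹ = (Complex.Gamma s)⁻¹ :=
  (Complex.one_div_Gamma_eq_self_mul_one_div_Gamma_add_one s).symm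

/-- The coefficient of `a` at `zᵏ`, with `β = u₂ - v₃`. -/
noncomputable def aCoeff (β : ℂ) (k : ℤ) : ℂ :=
  Complex.Gamma ((k : ℂ) + β + 1) / Complex.Gamma ((k : ℂ) + 1)

/-- The coefficient of `b` at `yʲ`, with `γ = u₁ - v₃` and `δ = u₁ - u₃`. -/
noncomputable def bCoeff (γ δ : ℂ) (j : ℕ) : ℂ :=
  Complex.Gamma ((j : ℂ) + γ + 1) / Complex.Gamma ((j : ℂ) + δ + 1)

/-- The coefficient of `c` at `zᵏ`, with `α = u₂ - u₃`. -/
noncomputable def cCoeff (α : ℂ) (k : ℤ) : ℂ :=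
  Complex.Gamma ((k : ℂ) + 1) / Complex.Gamma ((k : ℂ) + α + 1)

theorem aCoeff_of_neg (β : ℂ) {k : ℤ} (hk : k < 0) : aCoeff β k = 0 := by
  obtain ⟨n, hn⟩ := Int.eq_ofNat_of_zero_le (show 0 ≤ -k - 1 by omega)
  have : (k : ℂ) + 1 = -(n : ℂ) := by
    have h : k = -(n : ℤ) - 1 := by omega
    rw [h]; push_cast; ring
  rw [aCoeff, this, Complex.Gamma_neg_nat_eq_zero, div_zero]

theorem aCoeff_succ {β : ℂ} (hβ : ∀ m : ℤ, β ≠ m) (k : ℤ) :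
    ((k : ℂ) + 1) * aCoeff β (k + 1) = (k + β + 1) * aCoeff β k := by
  have hne : (k : ℂ) + β + 1 ≠ 0 := fun h =>
    hβ (-k - 1) (by push_cast; linear_combination h)
  have hinv := mul_inv_Gamma_add_one ((k : ℂ) + 1)
  have hG := Complex.Gamma_add_one _ hne
  rw [aCoeff, aCoeff, div_eq_mul_inv, div_eq_mul_inv, ← hinv, Int.cast_add, Int.cast_one,
    show (k : ℂ) + 1 + β + 1 = k + β + 1 + 1 by ring, hG]
  ring

theorem bCoeff_succ {γ δ : ℂ} (hγ : ∀ m : ℤ, γ ≠ m) (j : ℕ) :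
    ((j : ℂ) + δ + 1) * bCoeff γ δ (j + 1) = (j + γ + 1) * bCoeff γ δ j := by
  have hne : (j : ℂ) + γ + 1 ≠ 0 := fun h =>
    hγ (-j - 1) (by push_cast; linear_combination h)
  have hinv := mul_inv_Gamma_add_one ((j : ℂ) + δ + 1)
  have hG := Complex.Gamma_add_one _ hne
  rw [bCoeff, bCoeff, div_eq_mul_inv, div_eq_mul_inv, ← hinv, Nat.cast_add, Nat.cast_one,
    show (j : ℂ) + 1 + γ + 1 = j + γ + 1 + 1 by ring,
    show (j : ℂ) + 1 + δ + 1 = j + δ + 1 + 1 by ring, hG]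
  ring

theorem cCoeff_succ (α : ℂ) (k : ℕ) :
    ((k : ℂ) + α + 1) * cCoeff α (k + 1) = (k + 1) * cCoeff α k := by
  have hinv := mul_inv_Gamma_add_one ((k : ℂ) + α + 1)
  have hG := Complex.Gamma_add_one _ (Nat.cast_add_one_ne_zero k : (k : ℂ) + 1 ≠ 0)
  rw [cCoeff, cCoeff, div_eq_mul_inv, div_eq_mul_inv, Int.cast_add, Int.cast_one,
    Int.cast_natCast, ← hinv, show (k : ℂ) + 1 + α + 1 = k + α + 1 + 1 by ring, hG]
  ring

theorem aop_eq_diagOp (u₂ v₃ : ℂ) : aop u₂ v₃ = diagOp fun p => aCoeff (u₂ - v₃) p.2.2 := rfl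

theorem bop_eq_diagOp (u₁ u₃ v₃ : ℂ) :
    bop u₁ u₃ v₃ = diagOp fun p => bCoeff (u₁ - v₃) (u₁ - u₃) p.2.1 := rfl

theorem cop_eq_diagOp (u₂ u₃ : ℂ) : cop u₂ u₃ = diagOp fun p => cCoeff (u₂ - u₃) p.2.2 := rfl

/-! ### Intertwining relations of the factors -/

section Factors

variable (u₁ u₂ u₃ v₃ : ℂ) (v : A19)

theorem aop_mz_mz_dz (h1 : ∀ m : ℤ, u₂ - v₃ ≠ (m : ℂ)) :
    aop u₂ v₃ (mz (mz (dz v))) + aop u₂ v₃ (mz v) =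
      mz (mz (dz (aop u₂ v₃ v))) + (u₂ - v₃ + 1) • mz (aop u₂ v₃ v) :=
  A19_end_ext (f := aop u₂ v₃ * (mz * mz * dz) + aop u₂ v₃ * mz)
    (g := mz * mz * dz * aop u₂ v₃ + (u₂ - v₃ + 1) • (mz * aop u₂ v₃)) (fun i j k => by
    simp only [aop_eq_diagOp, Module.End.mul_apply, LinearMap.add_apply, LinearMap.smul_apply,
      diagOp_e19, mz_e19, dz_e19, map_smul, sub_add_cancel, smul_smul, ← add_smul]
    congr 1
    linear_combination aCoeff_succ h1 k) v

theorem aop_dz (h1 : ∀ m : ℤ, u₂ - v₃ ≠ (m : ℂ)) :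
    aop u₂ v₃ (dz v) + (u₂ - v₃) • aop u₂ v₃ (mzInv v) = dz (aop u₂ v₃ v) :=
  A19_end_ext (f := aop u₂ v₃ * dz + (u₂ - v₃) • (aop u₂ v₃ * mzInv))
    (g := dz * aop u₂ v₃) (fun i j k => by
    simp only [aop_eq_diagOp, Module.End.mul_apply, LinearMap.add_apply, LinearMap.smul_apply,
      diagOp_e19, mzInv_e19, dz_e19, map_smul, smul_smul, ← add_smul]
    congr 1
    have := aCoeff_succ h1 (k - 1)
    rw [sub_add_cancel] at this
    push_cast at this
    linear_combination -this) v

theorem bop_my_my_dy (h2 : ∀ m : ℤ, u₁ - v₃ ≠ (m : ℂ)) :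
    bop u₁ u₃ v₃ (my (my (dy v))) + (u₁ - u₃ + 1) • bop u₁ u₃ v₃ (my v) =
      my (my (dy (bop u₁ u₃ v₃ v))) + (u₁ - v₃ + 1) • my (bop u₁ u₃ v₃ v) :=
  A19_end_ext (f := bop u₁ u₃ v₃ * (my * my * dy) + (u₁ - u₃ + 1) • (bop u₁ u₃ v₃ * my))
    (g := my * my * dy * bop u₁ u₃ v₃ + (u₁ - v₃ + 1) • (my * bop u₁ u₃ v₃)) (fun i j k => by
    have hdy : my (dy (e19 (i, j, k))) = (j : ℂ) • e19 (i, j, k) := by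
      cases j <;> simp [dy_e19, my_e19]
    simp only [bop_eq_diagOp, Module.End.mul_apply, LinearMap.add_apply, LinearMap.smul_apply,
      diagOp_e19, hdy, my_e19, map_smul, smul_smul, ← add_smul]
    congr 1
    linear_combination bCoeff_succ (δ := u₁ - u₃) h2 j) v

theorem cop_mz_mz_dz (i j k : ℕ) :
    cop u₂ u₃ (mz (mz (dz (e19 (i, j, (k : ℤ)))))) +
        (u₂ - u₃ + 1) • cop u₂ u₃ (mz (e19 (i, j, (k : ℤ)))) =
      mz (mz (dz (cop u₂ u₃ (e19 (i, j, (k : ℤ)))))) + mz (cop u₂ u₃ (e19 (i, j, (k : ℤ)))) := by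
  simp only [cop_eq_diagOp, diagOp_e19, mz_e19, dz_e19, map_smul, sub_add_cancel, smul_smul,
    ← add_smul]
  congr 1
  push_cast
  linear_combination cCoeff_succ (u₂ - u₃) k

/-- Up to a multiple of a monomial with negative `z`-exponent, `c` intertwines `∂_z` with
`∂_z + (u₂ - u₃) z⁻¹` on polynomials. -/
theorem exists_cop_dz (i j k : ℕ) : ∃ s : ℂ,
    cop u₂ u₃ (dz (e19 (i, j, (k : ℤ)))) =
      dz (cop u₂ u₃ (e19 (i, j, (k : ℤ)))) + (u₂ - u₃) • mzInv (cop u₂ u₃ (e19 (i, j, (k : ℤ))))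
        + s • e19 (i, j, -1) := by
  cases k with
  | zero =>
    refine ⟨-((u₂ - u₃) * cCoeff (u₂ - u₃) 0), ?_⟩
    simp [cop_eq_diagOp, diagOp_e19, mzInv_e19, dz_e19, smul_smul]
  | succ k =>
    refine ⟨0, ?_⟩
    simp only [cop_eq_diagOp, diagOp_e19, mzInv_e19, dz_e19, map_smul, smul_smul, ← add_smul,
      zero_smul, add_zero]
    congr 1
    push_cast
    rw [add_sub_cancel_right]
    linear_combination -cCoeff_succ (u₂ - u₃) k

/-- The part of `r` to the left of `c` kills monomials with negative `z`-exponent. -/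
theorem aop_shear_bop_shear_of_neg (ε η : ℂ) (i j : ℕ) {k : ℤ} (hk : k < 0) :
    aop u₂ v₃ (shear ε (bop u₁ u₃ v₃ (shear η (e19 (i, j, k))))) = 0 := by
  simp only [shear_e19, map_sum, map_smul, aop_eq_diagOp, bop_eq_diagOp, diagOp_e19]
  refine Finset.sum_eq_zero fun t _ => ?_
  rw [Finset.sum_eq_zero, smul_zero, smul_zero]
  intro s _
  rw [aCoeff_of_neg _ (by omega), zero_smul, smul_zero]

theorem rop_apply : rop u₁ u₂ u₃ v₃ v =
    aop u₂ v₃ (shear 1 (bop u₁ u₃ v₃ (shear (-1) (cop u₂ u₃ v)))) := by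
  rw [rop, sig19_eq_shear, sig19inv_eq_shear]
  rfl

end Factors

/-! ### Intertwining relations of the shears -/

section ShearRelations

variable (ε : ℂ) (v : A19)

theorem shear_euler_xy :
    shear ε (mx (dx v) + my (dy v)) = mx (dx (shear ε v)) + my (dy (shear ε v)) := by
  simp only [map_add, shear_mx, shear_my, shear_dx, shear_dy, map_sub, map_smul]
  module

theorem shear_euler_xz :
    shear ε (-mx (dx v) + mz (dz v)) = -mx (dx (shear ε v)) + mz (dz (shear ε v)) := by
  simp only [map_add, map_neg, shear_mx, shear_mz, shear_dx, shear_dz, map_smul, mz_my, mz_mzInv]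
  module

theorem shear_neg_one_lowering :
    shear (-1) (my (dx v) + mz (mz (dz v)) + mz v) =
      mz (mz (dz (shear (-1) v))) + mz (shear (-1) v) := by
  simp only [map_add, shear_my, shear_mz, shear_dx, shear_dz, map_smul, mz_my, mz_mzInv]
  module

theorem shear_one_lowering :
    shear 1 (mz (mz (dz v)) + mz v) =
      my (dx (shear 1 v)) + mz (mz (dz (shear 1 v))) + mz (shear 1 v) := by
  simp only [map_add, shear_mz, shear_dz, map_smul, mz_my, mz_mzInv]
  module

theorem shear_neg_one_raising (m α : ℂ) :
    shear (-1) (mx (mx (dx v)) + mx (my (dy v)) - mx (mz (dz v)) - my (dz v) -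
        α • my (mzInv v) + m • mx v) =
      mx (mx (dx (shear (-1) v))) + mx (my (dy (shear (-1) v))) - mx (mz (dz (shear (-1) v))) +
        m • mx (shear (-1) v) -
        mzInv (my (my (dy (shear (-1) v))) + (m + α) • my (shear (-1) v)) := by
  simp only [map_add, map_sub, map_smul, shear_mx, shear_my, shear_mz, shear_mzInv, shear_dx,
    shear_dy, shear_dz, my_mx, mz_my, mzInv_mx, mzInv_my, mz_mzInv, mzInv_mz]
  module

theorem shear_one_raising (m β : ℂ) :
    shear 1 (mx (mx (dx v)) + mx (my (dy v)) - mx (mz (dz v)) + m • mx v -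
        mzInv (my (my (dy v)) + (m + β) • my v)) =
      mx (mx (dx (shear 1 v))) + mx (my (dy (shear 1 v))) - mx (mz (dz (shear 1 v))) -
        my (dz (shear 1 v)) - β • my (mzInv (shear 1 v)) + m • mx (shear 1 v) := by
  simp only [map_add, map_sub, map_smul, shear_mx, shear_my, shear_mz, shear_mzInv, shear_dx,
    shear_dy, shear_dz, my_mx, mz_my, mzInv_mx, mzInv_my, mz_mzInv, mzInv_mz]
  module

theorem shear_neg_one_highest (n : ℂ) :
    shear (-1) (mx (my (dx v) + mz (mz (dz v)) + mz v) +
        my (my (dy v) + mz (dz v) + (n + 1) • v)) =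
      mx (mz (mz (dz (shear (-1) v)))) + mx (mz (shear (-1) v)) +
        (my (my (dy (shear (-1) v))) + n • my (shear (-1) v)) := by
  simp only [map_add, map_sub, map_smul, shear_mx, shear_my, shear_mz, shear_dx, shear_dy,
    shear_dz, mz_my, mzInv_my, mz_mzInv, mzInv_mz]
  module

theorem shear_one_highest (n : ℂ) :
    shear 1 (mx (mz (mz (dz v))) + mx (mz v) + (my (my (dy v)) + n • my v)) =
      mx (my (dx (shear 1 v)) + mz (mz (dz (shear 1 v))) + mz (shear 1 v)) +
        my (my (dy (shear 1 v)) + mz (dz (shear 1 v)) + (n + 1) • shear 1 v) := by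
  simp only [map_add, map_sub, map_smul, shear_mx, shear_my, shear_mz, shear_dy,
    shear_dz, mz_my, mzInv_my, mz_mzInv, mzInv_mz]
  module

end ShearRelations

/-! ### The six intertwining relations of `r` -/

section Relations

variable (u₁ u₂ u₃ v₃ : ℂ)

theorem rop_euler_xy (v : A19) : rop u₁ u₂ u₃ v₃ (mx (dx v) + my (dy v)) =
    mx (dx (rop u₁ u₂ u₃ v₃ v)) + my (dy (rop u₁ u₂ u₃ v₃ v)) := by
  have hdiag (g : ℕ × ℕ × ℤ → ℂ) (w : A19) : diagOp g (mx (dx w) + my (dy w)) =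
      mx (dx (diagOp g w)) + my (dy (diagOp g w)) := by
    rw [map_add, diagOp_mx_dx, diagOp_my_dy]
  simp only [rop_apply, aop_eq_diagOp, bop_eq_diagOp, cop_eq_diagOp, hdiag, shear_euler_xy]

theorem rop_dx (v : A19) : rop u₁ u₂ u₃ v₃ (dx v) = dx (rop u₁ u₂ u₃ v₃ v) := by
  rw [rop_apply, rop_apply, cop_eq_diagOp, diagOp_z_dx, shear_dx, bop_eq_diagOp, diagOp_y_dx,
    shear_dx, aop_eq_diagOp, diagOp_z_dx]

theorem rop_euler_xz (v : A19) : rop u₁ u₂ u₃ v₃ (-mx (dx v) + mz (dz v)) =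
    -mx (dx (rop u₁ u₂ u₃ v₃ v)) + mz (dz (rop u₁ u₂ u₃ v₃ v)) := by
  have hdiag (g : ℕ × ℕ × ℤ → ℂ) (w : A19) : diagOp g (-mx (dx w) + mz (dz w)) =
      -mx (dx (diagOp g w)) + mz (dz (diagOp g w)) := by
    rw [map_add, map_neg, diagOp_mx_dx, diagOp_mz_dz]
  simp only [rop_apply, aop_eq_diagOp, bop_eq_diagOp, cop_eq_diagOp, hdiag, shear_euler_xz]

theorem rop_lowering (h1 : ∀ m : ℤ, u₂ - v₃ ≠ (m : ℂ)) (i j k : ℕ) {v : A19}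
    (hv : v = e19 (i, j, (k : ℤ))) :
    rop u₁ u₂ u₃ v₃ (my (dx v) + mz (mz (dz v)) + (u₂ - u₃ + 1) • mz v) =
      my (dx (rop u₁ u₂ u₃ v₃ v)) + mz (mz (dz (rop u₁ u₂ u₃ v₃ v))) +
        (u₂ - v₃ + 1) • mz (rop u₁ u₂ u₃ v₃ v) := by
  have hc : cop u₂ u₃ (my (dx v) + mz (mz (dz v)) + (u₂ - u₃ + 1) • mz v) =
      my (dx (cop u₂ u₃ v)) + mz (mz (dz (cop u₂ u₃ v))) + mz (cop u₂ u₃ v) := by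
    rw [add_assoc, add_assoc, hv, ← cop_mz_mz_dz]
    simp only [map_add, map_smul, cop_eq_diagOp, diagOp_z_my, diagOp_z_dx]
  have hb (w : A19) : bop u₁ u₃ v₃ (mz (mz (dz w)) + mz w) =
      mz (mz (dz (bop u₁ u₃ v₃ w))) + mz (bop u₁ u₃ v₃ w) := by
    simp only [map_add, bop_eq_diagOp, diagOp_y_mz, diagOp_y_dz]
  have ha (w : A19) : aop u₂ v₃ (my (dx w) + mz (mz (dz w)) + mz w) =
      my (dx (aop u₂ v₃ w)) + mz (mz (dz (aop u₂ v₃ w))) + (u₂ - v₃ + 1) • mz (aop u₂ v₃ w) := by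
    rw [add_assoc, map_add, map_add, aop_mz_mz_dz _ _ _ h1, add_assoc]
    simp only [aop_eq_diagOp, diagOp_z_my, diagOp_z_dx]
  simp only [rop_apply]
  rw [hc, shear_neg_one_lowering, hb, shear_one_lowering, ha]

theorem rop_raising (h1 : ∀ m : ℤ, u₂ - v₃ ≠ (m : ℂ)) (h2 : ∀ m : ℤ, u₁ - v₃ ≠ (m : ℂ))
    (i j k : ℕ) {v : A19} (hv : v = e19 (i, j, (k : ℤ))) :
    rop u₁ u₂ u₃ v₃ (mx (mx (dx v)) + mx (my (dy v)) - mx (mz (dz v)) - my (dz v) +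
        (u₁ - u₂ + 1) • mx v) =
      mx (mx (dx (rop u₁ u₂ u₃ v₃ v))) + mx (my (dy (rop u₁ u₂ u₃ v₃ v))) -
        mx (mz (dz (rop u₁ u₂ u₃ v₃ v))) - my (dz (rop u₁ u₂ u₃ v₃ v)) +
        (u₁ - u₂ + 1) • mx (rop u₁ u₂ u₃ v₃ v) := by
  obtain ⟨s, hs⟩ := exists_cop_dz u₂ u₃ i j k
  have hc : cop u₂ u₃ (mx (mx (dx v)) + mx (my (dy v)) - mx (mz (dz v)) - my (dz v) +
        (u₁ - u₂ + 1) • mx v) =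
      (mx (mx (dx (cop u₂ u₃ v))) + mx (my (dy (cop u₂ u₃ v))) - mx (mz (dz (cop u₂ u₃ v))) -
        my (dz (cop u₂ u₃ v)) - (u₂ - u₃) • my (mzInv (cop u₂ u₃ v)) +
        (u₁ - u₂ + 1) • mx (cop u₂ u₃ v)) - s • e19 (i, j + 1, -1) := by
    have hdz : cop u₂ u₃ (my (dz v)) = my (cop u₂ u₃ (dz v)) := by
      rw [cop_eq_diagOp, diagOp_z_my]
    rw [map_add, map_sub, hdz, hv, hs, map_add, map_add, map_smul, map_smul, my_e19]
    simp only [map_add, map_sub, map_smul, cop_eq_diagOp, diagOp_z_mx, diagOp_mx_dx,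
      diagOp_my_dy, diagOp_mz_dz]
    module
  have hb (w : A19) : bop u₁ u₃ v₃ (mx (mx (dx w)) + mx (my (dy w)) - mx (mz (dz w)) +
        (u₁ - u₂ + 1) • mx w - mzInv (my (my (dy w)) + (u₁ - u₂ + 1 + (u₂ - u₃)) • my w)) =
      mx (mx (dx (bop u₁ u₃ v₃ w))) + mx (my (dy (bop u₁ u₃ v₃ w))) -
        mx (mz (dz (bop u₁ u₃ v₃ w))) + (u₁ - u₂ + 1) • mx (bop u₁ u₃ v₃ w) -
        mzInv (my (my (dy (bop u₁ u₃ v₃ w))) +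
          (u₁ - u₂ + 1 + (u₂ - v₃)) • my (bop u₁ u₃ v₃ w)) := by
    have key := bop_my_my_dy u₁ u₃ v₃ w h2
    rw [show u₁ - u₂ + 1 + (u₂ - u₃) = u₁ - u₃ + 1 by ring,
      show u₁ - u₂ + 1 + (u₂ - v₃) = u₁ - v₃ + 1 by ring, ← key]
    simp only [map_add, map_sub, map_smul, bop_eq_diagOp, diagOp_y_mx, diagOp_mx_dx,
      diagOp_my_dy, diagOp_mz_dz, diagOp_y_mzInv]
  have ha (w : A19) : aop u₂ v₃ (mx (mx (dx w)) + mx (my (dy w)) - mx (mz (dz w)) -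
        my (dz w) - (u₂ - v₃) • my (mzInv w) + (u₁ - u₂ + 1) • mx w) =
      mx (mx (dx (aop u₂ v₃ w))) + mx (my (dy (aop u₂ v₃ w))) - mx (mz (dz (aop u₂ v₃ w))) -
        my (dz (aop u₂ v₃ w)) + (u₁ - u₂ + 1) • mx (aop u₂ v₃ w) := by
    have hdz : my (dz (aop u₂ v₃ w)) =
        my (aop u₂ v₃ (dz w)) + (u₂ - v₃) • my (aop u₂ v₃ (mzInv w)) := by
      rw [← aop_dz _ _ w h1, map_add, map_smul]
    rw [hdz]
    simp only [map_add, map_sub, map_smul, aop_eq_diagOp, diagOp_z_mx, diagOp_z_my, diagOp_mx_dx,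
      diagOp_my_dy, diagOp_mz_dz]
    module
  simp only [rop_apply]
  rw [hc]
  simp only [map_sub _ _ (s • _), map_smul _ s, aop_shear_bop_shear_of_neg _ _ _ _ _ _ _ _
    (neg_one_lt_zero : (-1 : ℤ) < 0), smul_zero, sub_zero]
  rw [shear_neg_one_raising, hb, shear_one_raising, ha]

theorem rop_highest (h1 : ∀ m : ℤ, u₂ - v₃ ≠ (m : ℂ)) (h2 : ∀ m : ℤ, u₁ - v₃ ≠ (m : ℂ))
    (i j k : ℕ) {v : A19} (hv : v = e19 (i, j, (k : ℤ))) :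
    rop u₁ u₂ u₃ v₃ (mx (my (dx v) + mz (mz (dz v)) + (u₂ - u₃ + 1) • mz v) +
        my (my (dy v) + mz (dz v) + (u₁ - u₃ + 2) • v)) =
      mx (my (dx (rop u₁ u₂ u₃ v₃ v)) + mz (mz (dz (rop u₁ u₂ u₃ v₃ v))) +
          (u₂ - v₃ + 1) • mz (rop u₁ u₂ u₃ v₃ v)) +
        my (my (dy (rop u₁ u₂ u₃ v₃ v)) + mz (dz (rop u₁ u₂ u₃ v₃ v)) +
          (u₁ - v₃ + 2) • rop u₁ u₂ u₃ v₃ v) := by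
  have hc : cop u₂ u₃ (mx (my (dx v) + mz (mz (dz v)) + (u₂ - u₃ + 1) • mz v) +
        my (my (dy v) + mz (dz v) + (u₁ - u₃ + 2) • v)) =
      mx (my (dx (cop u₂ u₃ v)) + mz (mz (dz (cop u₂ u₃ v))) + mz (cop u₂ u₃ v)) +
        my (my (dy (cop u₂ u₃ v)) + mz (dz (cop u₂ u₃ v)) +
          (u₁ - u₃ + 1 + 1) • cop u₂ u₃ v) := by
    rw [add_assoc (my (dx _)), add_assoc (my (dx (cop u₂ u₃ v))), hv, ← cop_mz_mz_dz]
    simp only [map_add, map_smul, cop_eq_diagOp, diagOp_z_mx, diagOp_z_my, diagOp_z_dx,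
      diagOp_my_dy, diagOp_mz_dz]
    module
  have hb (w : A19) : bop u₁ u₃ v₃ (mx (mz (mz (dz w))) + mx (mz w) +
        (my (my (dy w)) + (u₁ - u₃ + 1) • my w)) =
      mx (mz (mz (dz (bop u₁ u₃ v₃ w)))) + mx (mz (bop u₁ u₃ v₃ w)) +
        (my (my (dy (bop u₁ u₃ v₃ w))) + (u₁ - v₃ + 1) • my (bop u₁ u₃ v₃ w)) := by
    rw [← bop_my_my_dy u₁ u₃ v₃ w h2]
    simp only [map_add, map_smul, bop_eq_diagOp, diagOp_y_mx, diagOp_y_mz, diagOp_y_dz]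
  have ha (w : A19) : aop u₂ v₃ (mx (my (dx w) + mz (mz (dz w)) + mz w) +
        my (my (dy w) + mz (dz w) + (u₁ - v₃ + 1 + 1) • w)) =
      mx (my (dx (aop u₂ v₃ w)) + mz (mz (dz (aop u₂ v₃ w))) +
          (u₂ - v₃ + 1) • mz (aop u₂ v₃ w)) +
        my (my (dy (aop u₂ v₃ w)) + mz (dz (aop u₂ v₃ w)) +
          (u₁ - v₃ + 2) • aop u₂ v₃ w) := by
    rw [add_assoc (my (dx _)), add_assoc (my (dx (aop u₂ v₃ w))), ← aop_mz_mz_dz _ _ _ h1]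
    simp only [map_add, map_smul, aop_eq_diagOp, diagOp_z_mx, diagOp_z_my, diagOp_z_dx,
      diagOp_my_dy, diagOp_mz_dz]
    module
  simp only [rop_apply]
  rw [hc, shear_neg_one_highest, hb, shear_one_highest, ha]

end Relations

/-- The operator `r = a ∘ σ ∘ b ∘ σ⁻¹ ∘ c : ℂ[x,y,z] → A` satisfies the defining system of
the `sl(3)` operator `ℛ₃`; each identity is recorded on the monomial basis `xⁱyʲzᵏ`
(`i,j,k ∈ ℕ`) of the polynomial subspace `ℂ[x,y,z] ⊆ A`, which all the displayed
differential operators preserve. -/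
theorem sl3_R3_operator (u₁ u₂ u₃ v₃ : ℂ)
    (h1 : ∀ m : ℤ, u₂ - v₃ ≠ (m : ℂ)) (h2 : ∀ m : ℤ, u₁ - v₃ ≠ (m : ℂ))
    (h3 : ∀ m : ℤ, u₁ - u₃ ≠ (m : ℂ)) :
    -- (i)  r(x∂ₓ + y∂_y) = (x∂ₓ + y∂_y) r
    (∀ i j k : ℕ,
      (rop u₁ u₂ u₃ v₃ * (mx * dx + my * dy)) (e19 (i, j, (k : ℤ)))
        = ((mx * dx + my * dy) * rop u₁ u₂ u₃ v₃) (e19 (i, j, (k : ℤ)))) ∧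
    -- (ii)  r∂ₓ = ∂ₓ r
    (∀ i j k : ℕ,
      (rop u₁ u₂ u₃ v₃ * dx) (e19 (i, j, (k : ℤ)))
        = (dx * rop u₁ u₂ u₃ v₃) (e19 (i, j, (k : ℤ)))) ∧
    -- (iii)  r(−x∂ₓ + z∂_z) = (−x∂ₓ + z∂_z) r
    (∀ i j k : ℕ,
      (rop u₁ u₂ u₃ v₃ * (-(mx * dx) + mz * dz)) (e19 (i, j, (k : ℤ)))
        = ((-(mx * dx) + mz * dz) * rop u₁ u₂ u₃ v₃) (e19 (i, j, (k : ℤ)))) ∧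
    -- (iv)  r(y∂ₓ + z²∂_z + (u₂−u₃+1)z) = (y∂ₓ + z²∂_z + (u₂−v₃+1)z) r
    (∀ i j k : ℕ,
      (rop u₁ u₂ u₃ v₃ * (my * dx + mz * mz * dz + (u₂ - u₃ + 1) • mz)) (e19 (i, j, (k : ℤ)))
        = ((my * dx + mz * mz * dz + (u₂ - v₃ + 1) • mz) * rop u₁ u₂ u₃ v₃)
            (e19 (i, j, (k : ℤ)))) ∧
    -- (v)  r(x²∂ₓ + xy∂_y − xz∂_z − y∂_z + (u₁−u₂+1)x)
    --        = (x²∂ₓ + xy∂_y − xz∂_z − y∂_z + (u₁−u₂+1)x) r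
    (∀ i j k : ℕ,
      (rop u₁ u₂ u₃ v₃ *
          (mx * mx * dx + mx * my * dy - mx * mz * dz - my * dz + (u₁ - u₂ + 1) • mx))
          (e19 (i, j, (k : ℤ)))
        = ((mx * mx * dx + mx * my * dy - mx * mz * dz - my * dz + (u₁ - u₂ + 1) • mx) *
            rop u₁ u₂ u₃ v₃) (e19 (i, j, (k : ℤ)))) ∧
    -- (vi)  r(x(y∂ₓ+z²∂_z+(u₂−u₃+1)z) + y(y∂_y+z∂_z+u₁−u₃+2))
    --        = (x(y∂ₓ+z²∂_z+(u₂−v₃+1)z) + y(y∂_y+z∂_z+u₁−v₃+2)) r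
    (∀ i j k : ℕ,
      (rop u₁ u₂ u₃ v₃ *
          (mx * (my * dx + mz * mz * dz + (u₂ - u₃ + 1) • mz) +
           my * (my * dy + mz * dz + (u₁ - u₃ + 2) • 1))) (e19 (i, j, (k : ℤ)))
        = ((mx * (my * dx + mz * mz * dz + (u₂ - v₃ + 1) • mz) +
            my * (my * dy + mz * dz + (u₁ - v₃ + 2) • 1)) *
            rop u₁ u₂ u₃ v₃) (e19 (i, j, (k : ℤ)))) := by
  refine ⟨fun i j k => ?_, fun i j k => ?_, fun i j k => ?_, fun i j k => ?_, fun i j k => ?_,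
    fun i j k => ?_⟩ <;>
  simp only [Module.End.mul_apply, LinearMap.add_apply, LinearMap.sub_apply, LinearMap.neg_apply,
    LinearMap.smul_apply, Module.End.one_apply]
  · exact rop_euler_xy u₁ u₂ u₃ v₃ _
  · exact rop_dx u₁ u₂ u₃ v₃ _
  · exact rop_euler_xz u₁ u₂ u₃ v₃ _
  · exact rop_lowering u₁ u₂ u₃ v₃ h1 i j k rfl
  · exact rop_raising u₁ u₂ u₃ v₃ h1 h2 i j k rfl
  · exact rop_highest u₁ u₂ u₃ v₃ h1 h2 i j k rfl
end
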